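/- Let n, k ≥ 1 with nk ≥ 2 and let V = ℤⁿ \ ⋃_p p^k ℤⁿ be the set of k-free points of ℤⁿ. The patch counting entropy of V equals log(2)/ζ(nk): with N(ρ) the number of distinct ρ-patches (V − t) ∩ B_ρ(0), t ∈ ℤⁿ, one has lim_{ρ→∞} log N(ρ) / vol(B_ρ(0)) = log(2)/ζ(nk). -/

import Mathlib

open Filter Topology

/-- The set of `k`-free points of `ℤⁿ`: lattice points lying in no set `p^k ℤⁿ`. -/
def kfree (n k : ℕ) : Set (Fin n → ℤ) :=
  {x | ∀ p : ℕ, p.Prime → ¬ ∃ y : Fin n → ℤ, x = ((p : ℤ)^k) • y}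

/-- The number of distinct `ρ`-patches `(V − t) ∩ B_ρ(0)` of the `k`-free points of `ℤⁿ`. -/
noncomputable def NpatchK (n k : ℕ) (ρ : ℝ) : ℕ :=
  Nat.card ↥(Set.range fun t : Fin n → ℤ =>
    {y : Fin n → ℤ | y + t ∈ kfree n k ∧ ∑ i, ((y i : ℝ))^2 < ρ^2})

/-- divisibility of a lattice point by `p^k` -/
def Dvk {n : ℕ} (k p : ℕ) (x : Fin n → ℤ) : Prop := ∃ y : Fin n → ℤ, x = ((p : ℤ)^k) • y

theorem dvk_iff {n : ℕ} (k p : ℕ) (x : Fin n → ℤ) : Dvk k p x ↔ ∀ i, (p : ℤ)^k ∣ x i := by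
  constructor
  · rintro ⟨y, rfl⟩ i
    exact ⟨y i, rfl⟩
  · intro h
    choose y hy using h
    exact ⟨y, funext hy⟩

theorem abs_lt_of_ball {n : ℕ} {ρ : ℝ} (hρ : 0 ≤ ρ) {y : Fin n → ℝ}
    (h : ∑ i, (y i)^2 < ρ^2) (i : Fin n) : |y i| < ρ := by
  have h1 : (y i)^2 ≤ ∑ i, (y i)^2 :=
    Finset.single_le_sum (f := fun i => (y i)^2) (fun i _ => sq_nonneg _) (Finset.mem_univ i)
  exact abs_lt_of_sq_lt_sq (h1.trans_lt h) hρ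

theorem ball_sub_box {n : ℕ} {ρ : ℝ} (hρ : 0 ≤ ρ) {y : Fin n → ℤ}
    (h : ∑ i, ((y i : ℝ))^2 < ρ^2) : y ∈ Fintype.piFinset (fun _ : Fin n => Finset.Icc (-⌊ρ⌋) ⌊ρ⌋) := by
  rw [Fintype.mem_piFinset]
  intro i
  have := abs_lt.1 (abs_lt_of_ball hρ h i)
  rw [Finset.mem_Icc]
  constructor
  · have : -(y i) ≤ ⌊ρ⌋ := Int.le_floor.2 (by push_cast; linarith)
    linarith
  · exact Int.le_floor.2 (by linarith)

theorem ball_finite (n : ℕ) (ρ : ℝ) : {y : Fin n → ℤ | ∑ i, ((y i : ℝ))^2 < ρ^2}.Finite := by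
  refine (Fintype.piFinset (fun _ : Fin n => Finset.Icc (-⌊|ρ|⌋) ⌊|ρ|⌋)).finite_toSet.subset ?_
  intro y hy
  exact ball_sub_box (abs_nonneg ρ) (by simpa using hy)

/-- lattice points in the open ball -/
noncomputable def BF (n : ℕ) (ρ : ℝ) : Finset (Fin n → ℤ) := (ball_finite n ρ).toFinset

theorem mem_BF {n : ℕ} {ρ : ℝ} {y : Fin n → ℤ} : y ∈ BF n ρ ↔ ∑ i, ((y i : ℝ))^2 < ρ^2 := by
  simp [BF]

open Classical in
/-- lattice points in the ball not divisible by `p^k`, `p ∈ P` -/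
noncomputable def WF (n k : ℕ) (P : Finset ℕ) (ρ : ℝ) : Finset (Fin n → ℤ) :=
  (BF n ρ).filter (fun x => ∀ p ∈ P, ¬ Dvk k p x)

open Classical in
/-- `k`-free lattice points in the ball -/
noncomputable def VF (n k : ℕ) (ρ : ℝ) : Finset (Fin n → ℤ) :=
  (BF n ρ).filter (fun x => x ∈ kfree n k)

/-- volume of the unit ball -/
noncomputable def vb (n : ℕ) : ℝ :=
  (MeasureTheory.volume (Metric.ball (0 : EuclideanSpace ℝ (Fin n)) 1)).toReal

theorem vb_pos (n : ℕ) : 0 < vb n := by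
  refine ENNReal.toReal_pos ?_ ?_
  · exact (Metric.measure_ball_pos _ _ one_pos).ne'
  · exact MeasureTheory.measure_ball_lt_top.ne

theorem vol_ball (n : ℕ) (hn : 1 ≤ n) {ρ : ℝ} (hρ : 0 ≤ ρ) :
    (MeasureTheory.volume (Metric.ball (0 : EuclideanSpace ℝ (Fin n)) ρ)).toReal = vb n * ρ^n := by
  have : Nonempty (Fin n) := ⟨⟨0, hn⟩⟩
  rw [MeasureTheory.Measure.addHaar_ball _ _ hρ, ENNReal.toReal_mul, ENNReal.toReal_ofReal (by positivity)]
  simp [vb, mul_comm]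

open scoped Pointwise in
theorem BF_density (n : ℕ) :
    Tendsto (fun ρ : ℝ => ((BF n ρ).card : ℝ) / ρ^n) atTop (𝓝 (vb n)) := by
  set s : Set (Fin n → ℝ) := {x | ∑ i, (x i)^2 < 1} with hs
  have hpre : s = (WithLp.toLp 2) ⁻¹' (Metric.ball (0 : EuclideanSpace ℝ (Fin n)) 1) := by
    ext x
    simp only [hs, Set.mem_ofPred_eq, Set.mem_preimage, mem_ball_zero_iff, EuclideanSpace.norm_eq]
    rw [Real.sqrt_lt' one_pos]
    simp
  have hb : Bornology.IsBounded s := by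
    refine (Metric.isBounded_ball (x := (0 : Fin n → ℝ)) (r := 1)).subset ?_
    intro x hx
    rw [mem_ball_zero_iff, pi_norm_lt_iff one_pos]
    intro i
    rw [Real.norm_eq_abs]
    exact abs_lt_of_ball zero_le_one (by simpa [hs] using hx) i
  have hm : IsOpen s := by
    apply isOpen_lt <;> fun_prop
  have hc : Convex ℝ s := by
    rw [hpre]
    exact (convex_ball (0 : EuclideanSpace ℝ (Fin n)) 1).linear_preimage (WithLp.linearEquiv 2 ℝ (Fin n → ℝ)).symm.toLinearMap
  have hv : MeasureTheory.volume.real s = vb n := by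
    rw [vb, MeasureTheory.Measure.real, hpre]
    rw [(PiLp.volume_preserving_toLp (Fin n)).measure_preimage]
    exact measurableSet_ball.nullMeasurableSet
  have hsm : ∀ c : ℝ, 0 < c → ∀ x, x ∈ c • s ↔ ∑ i, (x i)^2 < c^2 := by
    intro c hc x
    rw [Set.mem_smul_set_iff_inv_smul_mem₀ hc.ne']
    simp only [hs, Set.mem_ofPred_eq, Pi.smul_apply, smul_eq_mul, mul_pow, ← Finset.mul_sum]
    rw [inv_pow, inv_mul_lt_iff₀ (by positivity), mul_one]
  have key := tendsto_card_div_pow_atTop_volume' s hb hm.measurableSet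
    (hc.addHaar_frontier _) (by
      intro x y hx hxy z hz
      rw [hsm x hx] at hz
      rw [hsm y (hx.trans_le hxy)]
      refine hz.trans_le ?_
      gcongr)
  rw [hv] at key
  refine key.congr' ?_
  filter_upwards [eventually_gt_atTop 0] with ρ hρ
  congr 2
  · rw [← Set.ncard_coe_finset, ← Set.ncard_image_of_injective (BF n ρ : Set (Fin n → ℤ)) (f := fun y : Fin n → ℤ => ρ⁻¹ • (fun i => (y i : ℝ))) ?_]
    · rw [Nat.card_coe_set_eq]
      congr 1
      ext x
      simp only [Set.mem_inter_iff, Set.mem_image, Finset.mem_coe, mem_BF]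
      constructor
      · rintro ⟨hx, hx2⟩
        obtain ⟨z, hz, rfl⟩ := hx2
        rw [SetLike.mem_coe, Module.Basis.mem_span_iff_repr_mem] at hz
        simp only [Pi.basisFun_repr] at hz
        choose y hy using hz
        simp only [algebraMap_int_eq, eq_intCast] at hy
        have hzy : z = fun i => (y i : ℝ) := funext fun i => (hy i).symm
        subst hzy
        refine ⟨y, ?_, rfl⟩
        rw [← Set.mem_inv_smul_set_iff₀ (by positivity), inv_inv, hsm ρ hρ] at hx
        exact hx
      · rintro ⟨y, hy, rfl⟩
        constructor
        · rw [← Set.mem_inv_smul_set_iff₀ (by positivity), inv_inv, hsm ρ hρ]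
          exact hy
        · refine ⟨_, ?_, rfl⟩
          rw [SetLike.mem_coe, Module.Basis.mem_span_iff_repr_mem]
          intro i
          exact ⟨y i, by simp⟩
    · intro a b hab
      have h2 := smul_right_injective (Fin n → ℝ) (inv_ne_zero hρ.ne') hab
      funext i
      have := congrFun h2 i
      exact_mod_cast this
  · simp

theorem WF_insert_card (n k : ℕ) (P : Finset ℕ) (p : ℕ) (hp : p.Prime) (hP : ∀ q ∈ P, q.Prime)
    (hpP : p ∉ P) (ρ : ℝ) :
    (WF n k (insert p P) ρ).card + (WF n k P (ρ / (p:ℝ)^k)).card = (WF n k P ρ).card := by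
  classical
  have hp0 : (0:ℝ) < (p:ℝ)^k := by have := hp.pos; positivity
  have hp0' : (p:ℤ)^k ≠ 0 := by have := hp.ne_zero; positivity
  have h1 : (WF n k P (ρ / (p:ℝ)^k)).card = ((WF n k P ρ).filter (fun x => Dvk k p x)).card := by
    refine Finset.card_bij (fun y _ => ((p:ℤ)^k) • y) ?_ ?_ ?_
    · intro y hy
      simp only [WF, Finset.mem_filter, mem_BF] at hy ⊢
      refine ⟨⟨?_, ?_⟩, y, rfl⟩
      · have := hy.1
        simp only [Pi.smul_apply, smul_eq_mul, Int.cast_mul, mul_pow, ← Finset.mul_sum]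
        rw [div_pow, lt_div_iff₀ (by positivity)] at this
        push_cast
        linarith
      · intro q hq hd
        apply hy.2 q hq
        rw [dvk_iff] at hd ⊢
        intro i
        refine IsCoprime.dvd_of_dvd_mul_left ?_ (hd i)
        apply IsCoprime.pow
        rw [Nat.isCoprime_iff_coprime, Nat.coprime_primes (hP q hq) hp]
        rintro rfl
        exact hpP hq
    · intro a _ b _ hab
      exact smul_right_injective (Fin n → ℤ) hp0' hab
    · intro x hx
      simp only [WF, Finset.mem_filter, mem_BF] at hx
      obtain ⟨⟨h1, h2⟩, y, rfl⟩ := hx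
      refine ⟨y, ?_, rfl⟩
      simp only [WF, Finset.mem_filter, mem_BF]
      constructor
      · simp only [Pi.smul_apply, smul_eq_mul, Int.cast_mul, mul_pow, ← Finset.mul_sum] at h1
        rw [div_pow, lt_div_iff₀ (by positivity)]
        push_cast at h1
        linarith
      · intro q hq hd
        apply h2 q hq
        rw [dvk_iff] at hd ⊢
        intro i
        exact (hd i).mul_left _
  rw [h1]
  have h2 : WF n k (insert p P) ρ = (WF n k P ρ).filter (fun x => ¬ Dvk k p x) := by
    ext x
    simp only [WF, Finset.mem_filter, Finset.forall_mem_insert]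
    tauto
  rw [h2, add_comm, Finset.card_filter_add_card_filter_not]

theorem WF_density (n k : ℕ) (P : Finset ℕ) (hP : ∀ q ∈ P, q.Prime) :
    Tendsto (fun ρ : ℝ => ((WF n k P ρ).card : ℝ) / ρ^n) atTop
      (𝓝 (vb n * ∏ p ∈ P, (1 - 1 / (p:ℝ)^(n*k)))) := by
  classical
  induction P using Finset.induction_on with
  | empty => simpa [WF] using BF_density n
  | insert p P hpP ih =>
    have hp : p.Prime := hP p (Finset.mem_insert_self _ _)
    have hP' : ∀ q ∈ P, q.Prime := fun q hq => hP q (Finset.mem_insert_of_mem hq)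
    have ih := ih hP'
    have hp0 : (0:ℝ) < (p:ℝ)^k := by have := hp.pos; positivity
    have h2 := (ih.comp (tendsto_id.atTop_div_const hp0)).mul_const (1 / (p:ℝ)^(n*k))
    have h3 := ih.sub h2
    rw [Finset.prod_insert hpP]
    refine (h3.congr' ?_).trans_eq ?_
    · filter_upwards [eventually_gt_atTop 0] with ρ hρ
      have := WF_insert_card n k P p hp hP' hpP ρ
      rw [← this]
      simp only [Function.comp, id]
      push_cast
      rw [div_pow, ← pow_mul, mul_comm k n]
      have hp1 : (0:ℝ) < (p:ℝ)^(n*k) := by have := hp.pos; positivity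
      generalize ((WF n k P (ρ / (p:ℝ)^k)).card : ℝ) = a
      generalize (p:ℝ)^(n*k) = b at hp1
      field_simp
      ring
    · congr 1; ring

theorem euler_prod (s : ℕ) (hs : 2 ≤ s) :
    Tendsto (fun M : ℕ => ∏ p ∈ Nat.primesBelow M, (1 - 1 / (p:ℝ)^s)) atTop
      (𝓝 (1 / ∑' m : ℕ, 1 / ((m : ℝ) + 1)^s)) := by
  let f : ℕ →*₀ ℝ :=
    { toFun := fun m => 1 / (m:ℝ)^s
      map_zero' := by simp; omega
      map_one' := by simp
      map_mul' := by intro a b; push_cast; rw [mul_pow]; simp [mul_comm] }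
  have hsum : Summable (fun m : ℕ => 1 / (m:ℝ)^s) := Real.summable_one_div_nat_pow.2 (by omega)
  have hf : ∀ m, f m = 1 / (m:ℝ)^s := fun _ => rfl
  have h1 := EulerProduct.eulerProduct_completely_multiplicative (f := f) (by
    simpa only [hf] using hsum.norm)
  have h2 : ∑' m, f m = ∑' m : ℕ, 1 / ((m : ℝ) + 1)^s := by
    have : Summable f := hsum
    rw [this.tsum_eq_zero_add]
    simp [hf]
    omega
  rw [h2] at h1
  have hpos : 0 < ∑' m : ℕ, 1 / ((m : ℝ) + 1)^s := by
    have : Summable (fun m : ℕ => 1 / ((m : ℝ) + 1)^s) := by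
      simpa using (summable_nat_add_iff 1).2 hsum
    exact this.tsum_pos (fun _ => by positivity) 0 (by simp)
  have h3 := h1.inv₀ hpos.ne'
  rw [one_div]
  refine h3.congr ?_
  intro M
  rw [← Finset.prod_inv_distrib]
  simp [hf]

theorem tail_small (s : ℕ) (hs : 2 ≤ s) (η : ℝ) (hη : 0 < η) :
    ∃ M0 : ℕ, ∀ M ≥ M0, ∀ b, ∑ m ∈ Finset.Ico M b, 1 / (m:ℝ)^s ≤ η := by
  have hsum : Summable (fun m : ℕ => 1 / (m:ℝ)^s) := Real.summable_one_div_nat_pow.2 (by omega)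
  obtain ⟨t, ht⟩ := summable_iff_vanishing_norm.1 hsum η hη
  refine ⟨t.sup id + 1, fun M hM b => ?_⟩
  refine (le_abs_self _).trans (ht _ ?_).le
  rw [Finset.disjoint_left]
  intro a ha hat
  have := Finset.le_sup (f := id) hat
  simp at this ha
  omega

theorem tri_ball {n : ℕ} {ρ C : ℝ} (hρ : 0 ≤ ρ) (hC : 0 ≤ C) {y r : Fin n → ℝ}
    (hy : ∑ i, (y i)^2 < ρ^2) (hr : ∑ i, (r i)^2 ≤ C^2) :
    ∑ i, (y i + r i)^2 < (ρ + C)^2 := by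
  have e : ∀ z : Fin n → ℝ, ‖(WithLp.toLp 2 z : EuclideanSpace ℝ (Fin n))‖^2 = ∑ i, (z i)^2 := by
    intro z
    rw [EuclideanSpace.norm_sq_eq]
    simp
  have h1 : ‖(WithLp.toLp 2 y : EuclideanSpace ℝ (Fin n))‖ < ρ := by
    rw [← e] at hy
    exact lt_of_pow_lt_pow_left₀ 2 hρ hy
  have h2 : ‖(WithLp.toLp 2 r : EuclideanSpace ℝ (Fin n))‖ ≤ C := by
    rw [← e] at hr
    exact le_of_sq_le_sq hr hC
  have h3 := norm_add_le (WithLp.toLp 2 y : EuclideanSpace ℝ (Fin n)) (WithLp.toLp 2 r)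
  have h4 := e (y + r)
  simp only [Pi.add_apply] at h4
  rw [← h4, WithLp.toLp_add]
  have : ‖(WithLp.toLp 2 y : EuclideanSpace ℝ (Fin n)) + WithLp.toLp 2 r‖ < ρ + C := by linarith
  gcongr

theorem patch_upper (n k : ℕ) (P : Finset ℕ) (hP : ∀ q ∈ P, q.Prime) :
    ∃ C : ℝ, 0 ≤ C ∧ ∃ K : ℕ, 0 < K ∧ ∀ ρ : ℝ, 0 < ρ →
      NpatchK n k ρ ≤ K * 2 ^ (WF n k P (ρ + C)).card := by
  classical
  set L : ℕ := ∏ p ∈ P, p^k with hL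
  have hL0 : 0 < L := Finset.prod_pos fun p hp => pow_pos (hP p hp).pos k
  set R : Finset (Fin n → ℤ) := Fintype.piFinset (fun _ : Fin n => Finset.Ico (0:ℤ) L) with hR
  have hR0 : 0 < R.card := by
    rw [Finset.card_pos]
    refine ⟨0, ?_⟩
    rw [hR, Fintype.mem_piFinset]
    intro i
    simp [hL0]
  refine ⟨n * L, by positivity, R.card, hR0, fun ρ hρ => ?_⟩
  set W := WF n k P (ρ + n * L) with hW
  have hsub : (Set.range fun t : Fin n → ℤ =>
      {y : Fin n → ℤ | y + t ∈ kfree n k ∧ ∑ i, ((y i : ℝ))^2 < ρ^2}) ⊆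
      (((R ×ˢ W.powerset).image (fun q : (Fin n → ℤ) × Finset (Fin n → ℤ) =>
        {y : Fin n → ℤ | y + q.1 ∈ q.2})) : Set (Set (Fin n → ℤ))) := by
    rintro _ ⟨t, rfl⟩
    rw [Finset.mem_coe, Finset.mem_image]
    set r : Fin n → ℤ := fun i => t i % L with hr
    have hrR : r ∈ R := by
      rw [hR, Fintype.mem_piFinset]
      intro i
      rw [Finset.mem_Ico]
      exact ⟨Int.emod_nonneg _ (by positivity), Int.emod_lt_of_pos _ (by positivity)⟩
    have hrC : ∑ i, ((r i : ℝ))^2 ≤ ((n:ℝ) * L)^2 := by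
      have : ∀ i ∈ Finset.univ, ((r i : ℝ))^2 ≤ (L:ℝ)^2 := by
        intro i _
        have h1 := Fintype.mem_piFinset.1 hrR i
        rw [Finset.mem_Ico] at h1
        have h2 : (0:ℝ) ≤ r i := by exact_mod_cast h1.1
        have h3 : (r i : ℝ) ≤ L := by exact_mod_cast h1.2.le
        gcongr
      have h2 := Finset.sum_le_sum this
      rw [Finset.sum_const, Finset.card_univ, Fintype.card_fin, nsmul_eq_mul] at h2
      refine h2.trans ?_
      rw [mul_pow]
      gcongr
      have : n ≤ n^2 := Nat.le_self_pow two_ne_zero n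
      exact_mod_cast this
    refine ⟨(r, W.filter (fun z => z - r + t ∈ kfree n k ∧ ∑ i, (((z - r) i : ℤ) : ℝ)^2 < ρ^2)), ?_, ?_⟩
    · rw [Finset.mem_product, Finset.mem_powerset]
      exact ⟨hrR, Finset.filter_subset _ _⟩
    · ext y
      simp only [Set.mem_ofPred_eq, Finset.mem_filter, add_sub_cancel_right]
      constructor
      · exact fun h => h.2
      · intro h
        refine ⟨?_, h⟩
        rw [hW, WF, Finset.mem_filter, mem_BF]
        constructor
        · have := tri_ball hρ.le (by positivity) h.2 hrC
          simpa using this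
        · intro p hp hd
          apply h.1 p (hP p hp)
          change Dvk k p _
          rw [dvk_iff] at hd ⊢
          intro i
          have h1 := hd i
          have h2 : ((p:ℤ)^k) ∣ (t i - r i) := by
            have h3 : (L:ℤ) ∣ t i - r i := Int.dvd_self_sub_emod
            refine dvd_trans ?_ h3
            have : p^k ∣ L := Finset.dvd_prod_of_mem (fun p => p^k) hp
            exact_mod_cast this
          have h4 := dvd_add h1 h2
          have h5 : (y + t) i = (y i + r i) + (t i - r i) := by
            rw [Pi.add_apply]; ring
          rw [h5]
          exact h4
  rw [NpatchK, Nat.card_coe_set_eq]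
  refine (Set.ncard_le_ncard hsub (Finset.finite_toSet _)).trans ?_
  rw [Set.ncard_coe_finset]
  refine Finset.card_image_le.trans ?_
  rw [Finset.card_product, Finset.card_powerset]

theorem VF_lower (n k : ℕ) (hk : 1 ≤ k) (M : ℕ) (hM : 3 ≤ M) (ρ : ℝ) (hρ : 0 < ρ) :
    ((WF n k (Nat.primesBelow M) ρ).card : ℝ) ≤ (VF n k ρ).card +
      3^n * ρ^n * ∑ m ∈ Finset.Ico M (⌈ρ⌉₊), 1 / (m:ℝ)^(n*k) := by
  classical
  have hsub : WF n k (Nat.primesBelow M) ρ ⊆ VF n k ρ ∪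
      ((Finset.Ico M (⌈ρ⌉₊)).filter (fun p : ℕ => (p:ℝ)^k < ρ)).biUnion (fun p =>
        (Fintype.piFinset (fun _ : Fin n => Finset.Icc (-⌊ρ/(p:ℝ)^k⌋) ⌊ρ/(p:ℝ)^k⌋)).image
          (fun y => ((p:ℤ)^k) • y)) := by
    intro x hx
    rw [WF, Finset.mem_filter, mem_BF] at hx
    rw [Finset.mem_union]
    by_cases hxV : x ∈ kfree n k
    · left
      rw [VF, Finset.mem_filter, mem_BF]
      exact ⟨hx.1, hxV⟩
    · right
      simp only [kfree, Set.mem_ofPred_eq] at hxV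
      push Not at hxV
      obtain ⟨p, hp, y, rfl⟩ := hxV
      have hp0 : (0:ℝ) < (p:ℝ)^k := by have := hp.pos; positivity
      have hy : ∑ i, ((y i : ℝ))^2 < (ρ/(p:ℝ)^k)^2 := by
        have h1 := hx.1
        simp only [Pi.smul_apply, smul_eq_mul, Int.cast_mul, mul_pow, ← Finset.mul_sum] at h1
        rw [div_pow, lt_div_iff₀ (by positivity)]
        push_cast at h1
        linarith
      rw [Finset.mem_biUnion]
      refine ⟨p, ?_, ?_⟩
      · have h4 : (p:ℝ)^k < ρ := by
          have hy0 : ∃ i, y i ≠ 0 := by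
            by_contra hcon
            push Not at hcon
            apply hx.2 2 (Nat.mem_primesBelow.2 ⟨by omega, Nat.prime_two⟩)
            rw [dvk_iff]
            intro i
            simp [hcon i]
          obtain ⟨i, hi⟩ := hy0
          have h2 := abs_lt_of_ball (by positivity) hy i
          have h3 : (1:ℝ) ≤ |(y i : ℝ)| := by exact_mod_cast Int.one_le_abs hi
          have h4 := h3.trans_lt h2
          rwa [lt_div_iff₀ hp0, one_mul] at h4
        rw [Finset.mem_filter, Finset.mem_Ico]
        refine ⟨⟨?_, ?_⟩, h4⟩
        · by_contra hlt
          push Not at hlt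
          exact hx.2 p (Nat.mem_primesBelow.2 ⟨hlt, hp⟩) ⟨y, rfl⟩
        · have h5 : (p:ℝ) ≤ (p:ℝ)^k := by
            exact_mod_cast Nat.le_self_pow (by omega) p
          rw [Nat.lt_ceil]
          linarith
      · exact Finset.mem_image_of_mem _ (ball_sub_box (by positivity) hy)
  have h1 := (Finset.card_le_card hsub).trans (Finset.card_union_le _ _)
  refine (Nat.cast_le (α := ℝ).2 h1).trans ?_
  rw [Nat.cast_add]
  gcongr
  refine (Nat.cast_le (α := ℝ).2 Finset.card_biUnion_le).trans ?_
  rw [Nat.cast_sum, Finset.mul_sum]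
  have h3 : ∀ p ∈ (Finset.Ico M (⌈ρ⌉₊)).filter (fun p : ℕ => (p:ℝ)^k < ρ),
      ((((Fintype.piFinset (fun _ : Fin n => Finset.Icc (-⌊ρ/(p:ℝ)^k⌋) ⌊ρ/(p:ℝ)^k⌋)).image
          (fun y => ((p:ℤ)^k) • y)).card : ℕ) : ℝ) ≤ 3^n * ρ^n * (1 / (p:ℝ)^(n*k)) := by
    intro p hp
    rw [Finset.mem_filter, Finset.mem_Ico] at hp
    have hpp : 0 < p := by omega
    have hp0 : (0:ℝ) < (p:ℝ)^k := by positivity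
    refine (Nat.cast_le (α := ℝ).2 Finset.card_image_le).trans ?_
    rw [Fintype.card_piFinset, Finset.prod_const, Finset.card_univ, Fintype.card_fin, Int.card_Icc]
    have h5 : 1 ≤ ρ/(p:ℝ)^k := by
      rw [le_div_iff₀ hp0]; linarith [hp.2]
    have h6 : (((⌊ρ/(p:ℝ)^k⌋ + 1 - -⌊ρ/(p:ℝ)^k⌋).toNat : ℕ) : ℝ) ≤ 3 * (ρ/(p:ℝ)^k) := by
      have h7 : (0:ℤ) ≤ ⌊ρ/(p:ℝ)^k⌋ := Int.floor_nonneg.2 (by positivity)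
      have h8 : (((⌊ρ/(p:ℝ)^k⌋ + 1 - -⌊ρ/(p:ℝ)^k⌋).toNat : ℤ)) = ⌊ρ/(p:ℝ)^k⌋ + 1 - -⌊ρ/(p:ℝ)^k⌋ :=
        Int.toNat_of_nonneg (by omega)
      have h9 : (((⌊ρ/(p:ℝ)^k⌋ + 1 - -⌊ρ/(p:ℝ)^k⌋).toNat : ℕ) : ℝ) =
          ⌊ρ/(p:ℝ)^k⌋ + 1 - -⌊ρ/(p:ℝ)^k⌋ := by exact_mod_cast h8
      rw [h9]
      have := Int.floor_le (ρ/(p:ℝ)^k)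
      linarith
    rw [Nat.cast_pow]
    refine (pow_le_pow_left₀ (by positivity) h6 n).trans_eq ?_
    rw [mul_pow, div_pow, ← pow_mul, mul_comm k n]
    ring
  refine (Finset.sum_le_sum h3).trans ?_
  exact Finset.sum_le_sum_of_subset_of_nonneg (Finset.filter_subset _ _)
    (fun _ _ _ => by positivity)

theorem cong_card (n R m : ℕ) (A : Finset (Fin n → ℕ)) (hA : ∀ a ∈ A, ∀ i, a i < R)
    (hc : ∀ a ∈ A, ∀ b ∈ A, ∀ i, a i % m = b i % m) : A.card ≤ (R / m + 1)^n := by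
  have h : (Fintype.piFinset (fun _ : Fin n => Finset.range (R / m + 1))).card = (R/m+1)^n := by
    rw [Fintype.card_piFinset, Finset.prod_const, Finset.card_univ, Fintype.card_fin,
      Finset.card_range]
  rw [← h]
  refine Finset.card_le_card_of_injOn (fun a i => a i / m) ?_ ?_
  · intro a ha
    rw [Finset.mem_coe, Fintype.mem_piFinset]
    intro i
    rw [Finset.mem_range]
    exact Nat.lt_succ_of_le (Nat.div_le_div_right (hA a ha i).le)
  · intro a ha b hb hab
    funext i
    have h1 := congrFun hab i
    simp only at h1
    have h2 := hc a ha b hb i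
    rw [← Nat.div_add_mod (a i) m, ← Nat.div_add_mod (b i) m, h1, h2]

theorem cong_bound (n k w p : ℕ) (hp : 0 < p) :
    (((w^k / p^k + 1)^n : ℕ) : ℝ) ≤ 1 + 2^n * (w:ℝ)^(n*k) * (1 / (p:ℝ)^(n*k)) := by
  rcases lt_or_ge (w^k) (p^k) with h | h
  · rw [Nat.div_eq_of_lt h]
    simp only [zero_add, one_pow, Nat.cast_one]
    have : (0:ℝ) ≤ 2^n * (w:ℝ)^(n*k) * (1 / (p:ℝ)^(n*k)) := by positivity
    linarith
  · have hp0 : (0:ℝ) < (p:ℝ)^k := by positivity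
    have h1 : ((w^k / p^k + 1 : ℕ) : ℝ) ≤ 2 * ((w:ℝ)^k / (p:ℝ)^k) := by
      have h2 : ((w^k / p^k : ℕ) : ℝ) ≤ (w:ℝ)^k / (p:ℝ)^k := by
        have := Nat.cast_div_le (α := ℝ) (m := w^k) (n := p^k)
        push_cast at this
        exact this
      have h3 : 1 ≤ (w:ℝ)^k / (p:ℝ)^k := by
        rw [le_div_iff₀ hp0, one_mul]
        exact_mod_cast h
      push_cast
      linarith
    rw [Nat.cast_pow]
    refine (pow_le_pow_left₀ (by positivity) h1 n).trans ?_
    rw [mul_pow, div_pow, ← pow_mul, ← pow_mul, mul_comm k n]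
    have : 2^n * ((w:ℝ)^(n*k) / (p:ℝ)^(n*k)) = 2^n * (w:ℝ)^(n*k) * (1 / (p:ℝ)^(n*k)) := by ring
    linarith

theorem sieve (n k : ℕ) (hk : 1 ≤ k) (hnk : 2 ≤ n * k) (S : Finset (Fin n → ℤ))
    (U : Finset ℕ) (hU : ∀ p ∈ U, p.Prime) (P0 : ℕ) (hP0 : 0 < P0)
    (hUP : ∀ p : ℕ, p.Prime → p < P0 → p ∈ U)
    (htail : ∀ b, (S.card : ℝ) * 2^n * ∑ m ∈ Finset.Ico P0 b, 1 / (m:ℝ)^(n*k) ≤ 1/2)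
    (t0 : Fin n → ℤ) :
    ∃ s : Fin n → ℕ, ∀ x ∈ S, ∀ p : ℕ, p.Prime → p ∉ U →
      ¬ Dvk k p (fun i => x i + t0 i + (∏ q ∈ U, q^k : ℕ) * s i) := by
  classical
  set Q : ℕ := ∏ q ∈ U, q^k with hQ
  have hQ0 : 0 < Q := Finset.prod_pos fun p hp => pow_pos (hU p hp).pos k
  set K : ℕ := ∑ x ∈ S, ∑ i, (x i + t0 i).natAbs with hK
  have hKb : ∀ x ∈ S, ∀ i, (x i + t0 i).natAbs ≤ K := by
    intro x hx i
    refine le_trans ?_ (Finset.single_le_sum (f := fun x : Fin n → ℤ => ∑ i, (x i + t0 i).natAbs)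
      (fun _ _ => Nat.zero_le _) hx)
    exact Finset.single_le_sum (f := fun i => (x i + t0 i).natAbs)
      (fun _ _ => Nat.zero_le _) (Finset.mem_univ i)
  set A : ℕ := K + Q with hA
  set w : ℕ := 2 * S.card * (A + 2) + 1 with hw
  have hw0 : 1 ≤ w := by omega
  by_contra hcon
  push Not at hcon
  set box : Finset (Fin n → ℕ) := Fintype.piFinset (fun _ : Fin n => Finset.range (w^k)) with hbox
  have hboxc : box.card = w^(n*k) := by
    rw [hbox, Fintype.card_piFinset, Finset.prod_const, Finset.card_univ, Fintype.card_fin,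
      Finset.card_range, ← pow_mul, mul_comm]
  have hboxlt : ∀ s ∈ box, ∀ i, s i < w^k := by
    intro s hs i
    exact Finset.mem_range.1 (Fintype.mem_piFinset.1 hs i)
  set Z : (Fin n → ℤ) → Finset (Fin n → ℕ) := fun x =>
    box.filter (fun s => ∀ i, x i + t0 i + (Q:ℤ) * s i = 0) with hZ
  set Bad : (Fin n → ℤ) → ℕ → Finset (Fin n → ℕ) := fun x p =>
    box.filter (fun s => Dvk k p (fun i => x i + t0 i + (Q:ℤ) * s i)) with hBad
  set I : Finset ℕ := (Finset.Ico P0 (A * w + 1)).filter (fun p => p.Prime ∧ p ∉ U) with hI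
  have hsub : box ⊆ S.biUnion (fun x => Z x ∪ I.biUnion (Bad x)) := by
    intro s hs
    obtain ⟨x, hx, p, hp, hpU, hd⟩ := hcon s
    rw [Finset.mem_biUnion]
    refine ⟨x, hx, ?_⟩
    rw [Finset.mem_union]
    by_cases hz : ∀ i, x i + t0 i + (Q:ℤ) * s i = 0
    · left
      exact Finset.mem_filter.2 ⟨hs, hz⟩
    · right
      push Not at hz
      obtain ⟨i, hi⟩ := hz
      rw [Finset.mem_biUnion]
      refine ⟨p, ?_, Finset.mem_filter.2 ⟨hs, hd⟩⟩
      rw [hI, Finset.mem_filter, Finset.mem_Ico]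
      refine ⟨⟨?_, ?_⟩, hp, hpU⟩
      · by_contra hlt
        exact hpU (hUP p hp (by omega))
      · have h1 := (dvk_iff _ _ _).1 hd i
        have h2 := Int.le_of_dvd (abs_pos.2 hi) ((dvd_abs _ _).2 h1)
        have h3 : |x i + t0 i + (Q:ℤ) * s i| ≤ K + Q * w^k := by
          refine (abs_add_le _ _).trans ?_
          have h4 : |x i + t0 i| ≤ K := by
            have := hKb x hx i
            rw [Int.abs_eq_natAbs]
            exact_mod_cast this
          have h5 : |(Q:ℤ) * s i| ≤ Q * w^k := by
            rw [abs_of_nonneg (by positivity)]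
            have := (hboxlt s hs i).le
            exact_mod_cast Nat.mul_le_mul_left Q this
          linarith
        have h6 : p^k ≤ K + Q * w^k := by exact_mod_cast h2.trans h3
        have h7 : K + Q * w^k ≤ (A * w)^k := by
          have h8 : 1 ≤ w^k := Nat.one_le_pow _ _ hw0
          have h9 : A ≤ A^k := Nat.le_self_pow (by omega) A
          calc K + Q * w^k ≤ K * w^k + Q * w^k := by gcongr; exact Nat.le_mul_of_pos_right K h8
            _ = A * w^k := by rw [hA]; ring
            _ ≤ A^k * w^k := by gcongr
            _ = (A*w)^k := by rw [mul_pow]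
        have h8 : p ≤ A * w := (Nat.pow_le_pow_iff_left (by omega)).1 (h6.trans h7)
        omega
  have hZc : ∀ x, (Z x).card ≤ 1 := by
    intro x
    rw [Finset.card_le_one]
    intro a ha b hb
    have ha := (Finset.mem_filter.1 ha).2
    have hb := (Finset.mem_filter.1 hb).2
    funext i
    have h1 : (Q:ℤ) * a i = Q * b i := by linarith [ha i, hb i]
    exact_mod_cast mul_left_cancel₀ (by positivity) h1
  have hBc : ∀ x, ∀ p ∈ I, ((Bad x p).card : ℝ) ≤
      1 + 2^n * (w:ℝ)^(n*k) * (1 / (p:ℝ)^(n*k)) := by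
    intro x p hp
    rw [hI, Finset.mem_filter] at hp
    refine le_trans ?_ (cong_bound n k w p hp.2.1.pos)
    rw [Nat.cast_le]
    apply cong_card
    · intro a ha i
      exact hboxlt a (Finset.mem_filter.1 ha).1 i
    · intro a ha b hb i
      have ha := (dvk_iff _ _ _).1 (Finset.mem_filter.1 ha).2 i
      have hb := (dvk_iff _ _ _).1 (Finset.mem_filter.1 hb).2 i
      have h1 := dvd_sub hb ha
      have h2 : ((p:ℤ)^k) ∣ Q * ((b i : ℤ) - a i) := by
        have h5 : (Q:ℤ) * ((b i : ℤ) - a i) =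
            (x i + t0 i + (Q:ℤ) * b i) - (x i + t0 i + (Q:ℤ) * a i) := by ring
        rw [h5]
        exact h1
      have hcop : IsCoprime ((p:ℤ)^k) (Q:ℤ) := by
        rw [hQ, Nat.cast_prod]
        apply IsCoprime.prod_right
        intro q hq
        rw [Nat.cast_pow]
        apply IsCoprime.pow
        rw [Nat.isCoprime_iff_coprime, Nat.coprime_primes hp.2.1 (hU q hq)]
        rintro rfl
        exact hp.2.2 hq
      have h3 := hcop.dvd_of_dvd_mul_left h2
      change a i ≡ b i [MOD p^k]
      rw [Nat.modEq_iff_dvd]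
      exact_mod_cast h3
  have hcount : (box.card : ℝ) ≤ ∑ x ∈ S, (1 + ∑ p ∈ I, (1 + 2^n * (w:ℝ)^(n*k) * (1 / (p:ℝ)^(n*k)))) := by
    refine (Nat.cast_le (α := ℝ).2 ((Finset.card_le_card hsub).trans Finset.card_biUnion_le)).trans ?_
    rw [Nat.cast_sum]
    refine Finset.sum_le_sum fun x _ => ?_
    refine (Nat.cast_le (α := ℝ).2 (Finset.card_union_le _ _)).trans ?_
    rw [Nat.cast_add]
    refine add_le_add (by exact_mod_cast hZc x) ?_
    refine (Nat.cast_le (α := ℝ).2 Finset.card_biUnion_le).trans ?_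
    rw [Nat.cast_sum]
    exact Finset.sum_le_sum fun p hp => hBc x p hp
  rw [Finset.sum_const, nsmul_eq_mul, Finset.sum_add_distrib, Finset.sum_const, nsmul_eq_mul,
    mul_one, ← Finset.mul_sum, hboxc, Nat.cast_pow] at hcount
  have hIc : (I.card : ℝ) ≤ A * w + 1 := by
    have : I.card ≤ A * w + 1 := (Finset.card_filter_le _ _).trans (by simp)
    exact_mod_cast this
  have hIs : ∑ p ∈ I, 1 / (p:ℝ)^(n*k) ≤ ∑ m ∈ Finset.Ico P0 (A*w+1), 1 / (m:ℝ)^(n*k) :=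
    Finset.sum_le_sum_of_subset_of_nonneg (Finset.filter_subset _ _) (fun _ _ _ => by positivity)
  have ht := htail (A*w+1)
  set T := ∑ m ∈ Finset.Ico P0 (A*w+1), 1 / (m:ℝ)^(n*k)
  set X := (w:ℝ)^(n*k)
  have hX : (w:ℝ)^2 ≤ X := pow_le_pow_right₀ (by exact_mod_cast hw0) hnk
  have hX0 : 0 ≤ X := by positivity
  have hwr : (w:ℝ) = 2 * S.card * (A + 2) + 1 := by rw [hw]; push_cast; ring
  have hw1 : (1:ℝ) ≤ w := by exact_mod_cast hw0
  have e1 : (S.card:ℝ) * (1 + (I.card + 2^n * X * ∑ p ∈ I, 1 / (p:ℝ)^(n*k))) ≤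
      (S.card:ℝ) * (1 + (A * w + 1 + 2^n * X * T)) := by gcongr
  have e2 : ((S.card:ℝ) * 2^n * T) * X ≤ 1/2 * X := by gcongr
  have e3 : (S.card:ℝ) * (A * w + 2) ≤ S.card * ((A + 2) * w) := by
    gcongr
    linarith
  have e4 : 2 * ((S.card:ℝ) * ((A + 2) * w)) = (w:ℝ)^2 - w := by
    have : (w:ℝ)^2 - w = (w - 1) * w := by ring
    rw [this]
    nth_rw 2 [hwr]
    ring
  nlinarith

theorem crt (n k : ℕ) (U : Finset ℕ) (hU : ∀ p ∈ U, p.Prime) (g : ℕ → Fin n → ℤ) :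
    ∃ t : Fin n → ℤ, ∀ p ∈ U, ∀ i, ((p:ℤ)^k) ∣ t i - g p i := by
  have h : ∀ i, ∃ t : ℤ, ∀ p ∈ U, ((p:ℤ)^k) ∣ t - g p i := by
    intro i
    obtain ⟨y, hy⟩ := IsDedekindDomain.exists_forall_sub_mem_ideal (R := ℤ) (s := U)
      (fun p : ℕ => Ideal.span {(p:ℤ)}) (fun _ => k)
      (by
        intro p hp
        have h1 : Prime (p:ℤ) := Nat.prime_iff_prime_int.1 (hU p hp)
        exact (Ideal.prime_span_singleton_iff).2 h1)
      (by
        intro p hp q hq hpq he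
        rw [Ideal.span_singleton_eq_span_singleton, Int.associated_iff_natAbs] at he
        exact hpq (by simpa using he))
      (fun p => g p.1 i)
    refine ⟨y, fun p hp => ?_⟩
    have := hy p hp
    rwa [Ideal.span_singleton_pow, Ideal.mem_span_singleton] at this
  choose t ht using h
  exact ⟨t, fun p hp i => ht i p hp⟩

theorem realize (n k : ℕ) (hk : 1 ≤ k) (hnk : 2 ≤ n * k) (ρ : ℝ) (hρ : 0 < ρ)
    (S : Finset (Fin n → ℤ)) (hS : S ⊆ VF n k ρ) :
    ∃ t : Fin n → ℤ, {y : Fin n → ℤ | y + t ∈ kfree n k ∧ ∑ i, ((y i : ℝ))^2 < ρ^2} = S := by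
  classical
  obtain ⟨M0, hM0⟩ := tail_small (n*k) hnk (1 / (2 * (S.card + 1) * 2^n)) (by positivity)
  set P0 : ℕ := max (M0 + 1) (⌈2 * ρ⌉₊ + 1) with hP0
  have hP0M : M0 ≤ P0 := by omega
  have hP0ρ : 2 * ρ < P0 := by
    have h1 := Nat.le_ceil (2*ρ)
    have h2 : ⌈2 * ρ⌉₊ < P0 := by omega
    have h3 : ((⌈2 * ρ⌉₊ : ℕ) : ℝ) < P0 := by exact_mod_cast h2
    linarith
  set T := BF n ρ \ S with hT
  -- distinct large primes
  have hinf : {p : ℕ | p.Prime ∧ P0 ≤ p}.Infinite := by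
    rw [Set.infinite_iff_exists_gt]
    intro a
    obtain ⟨p, hp1, hp2⟩ := Nat.exists_infinite_primes (max (a+1) P0)
    exact ⟨p, ⟨hp2, by omega⟩, by omega⟩
  obtain ⟨e, he1, he2⟩ : ∃ e : (Fin n → ℤ) → ℕ, (∀ z ∈ T, (e z).Prime ∧ P0 ≤ e z) ∧
      Set.InjOn e (T : Set (Fin n → ℤ)) := by
    obtain ⟨F, hF, hFc⟩ := hinf.exists_subset_card_eq T.card
    obtain ⟨φ⟩ : Nonempty (T ≃ F) := ⟨Finset.equivOfCardEq hFc.symm⟩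
    refine ⟨fun z => if h : z ∈ T then (φ ⟨z, h⟩ : ℕ) else 0, ?_, ?_⟩
    · intro z hz
      simp only [dif_pos hz]
      exact hF (φ ⟨z, hz⟩).2
    · intro a ha b hb hab
      have ha' : a ∈ T := ha
      have hb' : b ∈ T := hb
      simp only [dif_pos ha', dif_pos hb'] at hab
      have := φ.injective (Subtype.ext hab)
      exact congrArg Subtype.val this
  set U : Finset ℕ := Nat.primesBelow P0 ∪ T.image e with hUdef
  have hU : ∀ p ∈ U, p.Prime := by
    intro p hp
    rw [hUdef, Finset.mem_union, Nat.mem_primesBelow, Finset.mem_image] at hp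
    rcases hp with hp | ⟨z, hz, rfl⟩
    · exact hp.2
    · exact (he1 z hz).1
  obtain ⟨g, hg1, hg2⟩ : ∃ g : ℕ → Fin n → ℤ, (∀ p < P0, g p = 0) ∧ ∀ z ∈ T, g (e z) = -z := by
    refine ⟨fun p => if h : ∃ z ∈ T, e z = p then -h.choose else 0, ?_, ?_⟩
    · intro p hp
      simp only
      rw [dif_neg]
      rintro ⟨z, hz, rfl⟩
      have := (he1 z hz).2
      omega
    · intro z hz
      have h : ∃ z' ∈ T, e z' = e z := ⟨z, hz, rfl⟩
      simp only
      rw [dif_pos h]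
      rw [he2 h.choose_spec.1 hz h.choose_spec.2]
  obtain ⟨t0, ht0⟩ := crt n k U hU g
  obtain ⟨s, hs⟩ := sieve n k hk hnk S U hU P0 (by omega)
    (fun p hp hlt => Finset.mem_union_left _ (Nat.mem_primesBelow.2 ⟨hlt, hp⟩))
    (by
      intro b
      have h1 := hM0 P0 hP0M b
      calc (S.card : ℝ) * 2^n * ∑ m ∈ Finset.Ico P0 b, 1 / (m:ℝ)^(n*k)
          ≤ ((S.card : ℝ) + 1) * 2^n * (1 / (2 * (S.card + 1) * 2^n)) := by
            gcongr
            linarith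
        _ = 1/2 := by field_simp)
    t0
  set Q : ℕ := ∏ q ∈ U, q^k with hQ
  have htg : ∀ p ∈ U, ∀ i, ((p:ℤ)^k) ∣ (t0 i + Q * s i) - g p i := by
    intro p hp i
    have h1 : ((p:ℤ)^k) ∣ Q := by
      have : p^k ∣ Q := Finset.dvd_prod_of_mem (fun p => p^k) hp
      exact_mod_cast this
    have h2 := dvd_add (ht0 p hp i) (h1.mul_right (s i : ℤ))
    have h3 : (t0 i + Q * s i) - g p i = t0 i - g p i + Q * s i := by ring
    rw [h3]
    exact h2
  refine ⟨fun i => t0 i + Q * s i, ?_⟩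
  ext x
  simp only [Set.mem_ofPred_eq, Finset.mem_coe]
  constructor
  · rintro ⟨hx1, hx2⟩
    by_contra hxS
    have hxT : x ∈ T := by
      rw [hT, Finset.mem_sdiff, mem_BF]
      exact ⟨hx2, hxS⟩
    apply hx1 (e x) (he1 x hxT).1
    change Dvk k (e x) _
    rw [dvk_iff]
    intro i
    have h1 := htg (e x) (Finset.mem_union_right _ (Finset.mem_image_of_mem _ hxT)) i
    rw [hg2 x hxT] at h1
    have h2 : (x + fun i => t0 i + (Q:ℤ) * s i) i = (t0 i + Q * s i) - (-x) i := by
      simp only [Pi.add_apply, Pi.neg_apply]; ring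
    rw [h2]
    exact h1
  · intro hxS
    have hxV := hS hxS
    rw [VF, Finset.mem_filter, mem_BF] at hxV
    refine ⟨?_, hxV.1⟩
    intro p hp hd
    change Dvk k p _ at hd
    by_cases hpU : p ∈ U
    · have hdi := (dvk_iff _ _ _).1 hd
      have hxg : ∀ i, ((p:ℤ)^k) ∣ x i + g p i := by
        intro i
        have h1 := dvd_sub (hdi i) (htg p hpU i)
        have h2 : x i + g p i = (x + fun i => t0 i + (Q:ℤ) * s i) i - ((t0 i + Q * s i) - g p i) := by
          simp only [Pi.add_apply]; ring
        rw [h2]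
        exact h1
      rw [hUdef, Finset.mem_union, Nat.mem_primesBelow, Finset.mem_image] at hpU
      rcases hpU with hlt | ⟨z, hz, rfl⟩
      · apply hxV.2 p hp
        change Dvk k p x
        rw [dvk_iff]
        intro i
        have := hxg i
        rw [hg1 p hlt.1] at this
        simpa using this
      · rw [hg2 z hz] at hxg
        rw [hT, Finset.mem_sdiff, mem_BF] at hz
        apply hz.2
        have : x = z := by
          funext i
          have h1 := hxg i
          rw [Pi.neg_apply] at h1
          by_contra hne
          have h2 := Int.le_of_dvd (abs_pos.2 (by omega : x i + -z i ≠ 0)) ((dvd_abs _ _).2 h1)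
          have h3 : (((e z : ℕ) : ℝ))^k ≤ |(x i : ℝ) + -z i| := by exact_mod_cast h2
          have h4 := abs_lt.1 (abs_lt_of_ball hρ.le hxV.1 i)
          have h5 := abs_lt.1 (abs_lt_of_ball hρ.le hz.1 i)
          have h6 : |(x i : ℝ) + -z i| < 2 * ρ := by
            rw [abs_lt]; constructor <;> linarith
          have hzT : z ∈ T := by
            rw [hT, Finset.mem_sdiff, mem_BF]; exact hz
          have h7 : P0 ≤ (e z)^k := (he1 z hzT).2.trans (Nat.le_self_pow (by omega) _)
          have h8 : (P0:ℝ) ≤ ((e z : ℕ) : ℝ)^k := by exact_mod_cast h7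
          linarith
        rw [← this]
        exact hxS
    · refine hs x hxS p hp hpU ?_
      have h2 : (x + fun i => t0 i + (Q:ℤ) * s i) = fun i => x i + t0 i + (Q:ℤ) * s i := by
        funext i
        simp only [Pi.add_apply]; ring
      rw [h2] at hd
      exact hd

theorem patch_lower (n k : ℕ) (hk : 1 ≤ k) (hnk : 2 ≤ n * k) (ρ : ℝ) (hρ : 0 < ρ) :
    2 ^ (VF n k ρ).card ≤ NpatchK n k ρ := by
  classical
  rw [NpatchK, Nat.card_coe_set_eq, ← Finset.card_powerset, ← Set.ncard_coe_finset,
    ← Set.ncard_image_of_injective _ (f := fun S : Finset (Fin n → ℤ) => (S : Set (Fin n → ℤ)))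
      Finset.coe_injective]
  apply Set.ncard_le_ncard
  · rintro _ ⟨S, hS, rfl⟩
    obtain ⟨t, ht⟩ := realize n k hk hnk ρ hρ S (Finset.mem_powerset.1 hS)
    exact ⟨t, ht⟩
  · refine (ball_finite n ρ).finite_subsets.subset ?_
    rintro _ ⟨t, rfl⟩ y hy
    exact hy.2

/-- The patch counting entropy of the `k`-free points of `ℤⁿ` (with `nk ≥ 2`) equals
`log 2 / ζ(nk)`, where `ζ(s) = Σ_{m≥1} m⁻ˢ`. -/
theorem kfree_patch_counting_entropy (n k : ℕ) (hn : 1 ≤ n) (hk : 1 ≤ k)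
    (hnk : 2 ≤ n * k) :
    Tendsto (fun ρ : ℝ => Real.log (NpatchK n k ρ) /
        (MeasureTheory.volume (Metric.ball (0 : EuclideanSpace ℝ (Fin n)) ρ)).toReal)
      atTop (𝓝 (Real.log 2 / ∑' m : ℕ, 1 / ((m : ℝ) + 1)^(n * k))) := by
  have hl2 : 0 < Real.log 2 := Real.log_pos one_lt_two
  have hv := vb_pos n
  have hE := (euler_prod (n*k) hnk).const_mul (Real.log 2)
  rw [mul_one_div] at hE
  set D : ℕ → ℝ := fun M => ∏ p ∈ Nat.primesBelow M, (1 - 1 / (p:ℝ)^(n*k)) with hD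
  have hprime : ∀ M, ∀ q ∈ Nat.primesBelow M, q.Prime := fun M q hq => (Nat.mem_primesBelow.1 hq).2
  have hpos : ∀ ρ : ℝ, 0 < ρ → 0 < NpatchK n k ρ := fun ρ hρ =>
    lt_of_lt_of_le (by positivity) (patch_lower n k hk hnk ρ hρ)
  rw [tendsto_order]
  constructor
  · intro a ha
    obtain ⟨b, hab, hb⟩ := exists_between ha
    obtain ⟨c, hbc, hc⟩ := exists_between hb
    obtain ⟨M0, hM0⟩ := tail_small (n*k) hnk ((c - b) * vb n / (3^n * Real.log 2))
      (by have : 0 < c - b := by linarith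
          positivity)
    obtain ⟨M, hMc, hM3⟩ := ((hE.eventually (lt_mem_nhds hc)).and
      (eventually_ge_atTop (max M0 3))).exists
    have hW := (((WF_density n k (Nat.primesBelow M) (hprime M)).div_const (vb n)).const_mul
      (Real.log 2)).sub_const (c - b)
    have hlt : a < Real.log 2 * (vb n * D M / vb n) - (c - b) := by
      rw [mul_div_cancel_left₀ _ hv.ne']
      have : c < Real.log 2 * D M := hMc
      linarith
    filter_upwards [hW.eventually (lt_mem_nhds hlt), eventually_gt_atTop 0] with ρ h1 hρ
    refine h1.trans_le ?_
    rw [vol_ball n hn hρ.le]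
    have h2 := VF_lower n k hk M (by omega) ρ hρ
    have h3 := hM0 M (by omega) ⌈ρ⌉₊
    have h4 : ((2 ^ (VF n k ρ).card : ℕ) : ℝ) ≤ NpatchK n k ρ := by
      exact_mod_cast patch_lower n k hk hnk ρ hρ
    have h5 := Real.log_le_log (by positivity) h4
    rw [Nat.cast_pow, Real.log_pow, Nat.cast_ofNat] at h5
    have hρn : 0 < ρ^n := by positivity
    rw [le_div_iff₀ (by positivity)]
    refine le_trans ?_ h5
    have h6 : 3^n * ρ^n * ∑ m ∈ Finset.Ico M (⌈ρ⌉₊), 1 / (m:ℝ)^(n*k) ≤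
        3^n * ρ^n * ((c - b) * vb n / (3^n * Real.log 2)) := by gcongr
    have h7 : 3^n * ρ^n * ((c - b) * vb n / (3^n * Real.log 2)) * Real.log 2 =
        (c - b) * vb n * ρ^n := by field_simp
    have h8 := mul_le_mul_of_nonneg_right (h2.trans (by gcongr : _ ≤ ((VF n k ρ).card : ℝ) +
      3^n * ρ^n * ((c - b) * vb n / (3^n * Real.log 2)))) hl2.le
    rw [add_mul, h7] at h8
    have h9 : (Real.log 2 * (((WF n k (Nat.primesBelow M) ρ).card : ℝ) / ρ^n / vb n) - (c - b)) *
        (vb n * ρ^n) = ((WF n k (Nat.primesBelow M) ρ).card : ℝ) * Real.log 2 -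
          (c - b) * vb n * ρ^n := by
      field_simp
    rw [h9]
    linarith
  · intro a ha
    obtain ⟨M, hMa⟩ := (hE.eventually (gt_mem_nhds ha)).exists
    obtain ⟨C, hC, K, hK, hup⟩ := patch_upper n k (Nat.primesBelow M) (hprime M)
    have hW := (WF_density n k (Nat.primesBelow M) (hprime M)).comp
      (tendsto_atTop_add_const_right atTop C tendsto_id)
    have hr : Tendsto (fun ρ : ℝ => ((ρ + C) / ρ)^n) atTop (𝓝 1) := by
      have h1 : Tendsto (fun ρ : ℝ => 1 + C / ρ) atTop (𝓝 (1 + 0)) :=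
        tendsto_const_nhds.add (tendsto_const_nhds.div_atTop tendsto_id)
      have h2 := h1.pow n
      simp only [add_zero, one_pow] at h2
      refine h2.congr' ?_
      filter_upwards [eventually_gt_atTop 0] with ρ hρ
      congr 1
      field_simp
    have hk0 : Tendsto (fun ρ : ℝ => Real.log K / (vb n * ρ^n)) atTop (𝓝 0) :=
      tendsto_const_nhds.div_atTop ((tendsto_pow_atTop (by omega)).const_mul_atTop hv)
    have hT := hk0.add (((hW.mul hr).div_const (vb n)).const_mul (Real.log 2))
    have hlt : 0 + Real.log 2 * (vb n * D M * 1 / vb n) < a := by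
      rw [mul_one, mul_div_cancel_left₀ _ hv.ne', zero_add]
      exact hMa
    filter_upwards [hT.eventually (gt_mem_nhds hlt), eventually_gt_atTop 0] with ρ h1 hρ
    refine lt_of_le_of_lt ?_ h1
    rw [vol_ball n hn hρ.le]
    have h4 : (NpatchK n k ρ : ℝ) ≤ (K:ℝ) * 2 ^ (WF n k (Nat.primesBelow M) (ρ + C)).card := by
      exact_mod_cast hup ρ hρ
    have hK' : (0:ℝ) < K := by exact_mod_cast hK
    have h5 := Real.log_le_log (by exact_mod_cast hpos ρ hρ) h4
    rw [Real.log_mul hK'.ne' (by positivity), Real.log_pow] at h5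
    rw [div_le_iff₀ (by positivity)]
    refine h5.trans_eq ?_
    simp only [Function.comp, id]
    have hρC : 0 < ρ + C := by linarith
    rw [div_pow]
    field_simp
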